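/- Let S = {v₁,…,vₙ} be an (n,k)-uframe at which the minimum of F over all (n,k)-uframes is attained. Then every vᵢ is an extreme point (vertex) of the polytope conv{±v₁,…,±vₙ}. -/

import Mathlib

open MeasureTheory
open scoped RealInnerProductSpace ENNReal

/-- `S` is an `(n,k)`-uframe: `∑ᵢ vᵢ ⊗ vᵢ = I_k`. -/
def IsUframe {n k : ℕ} (v : Fin n → EuclideanSpace ℝ (Fin k)) : Prop :=
  ∀ x : EuclideanSpace ℝ (Fin k), ∑ i, ⟪v i, x⟫ • v i = x

/-- `F(S)`: the volume of the convex hull of `{±v₁,…,±vₙ}` in `ℝᵏ`. -/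
noncomputable def Fvol {n k : ℕ} (v : Fin n → EuclideanSpace ℝ (Fin k)) : ℝ≥0∞ :=
  volume (convexHull ℝ (Set.range v ∪ Set.range fun i => -v i))

open Matrix in
theorem isUframe_iff_sum_vecMulVec {n k : ℕ} (v : Fin n → EuclideanSpace ℝ (Fin k)) :
    IsUframe v ↔ ∑ j, vecMulVec (v j).ofLp (v j).ofLp = 1 := by
  have key (x : EuclideanSpace ℝ (Fin k)) : (∑ i, ⟪v i, x⟫ • v i).ofLp =
      (∑ j, vecMulVec (v j).ofLp (v j).ofLp) *ᵥ x.ofLp := by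
    rw [Matrix.sum_mulVec, WithLp.ofLp_sum]
    refine Finset.sum_congr rfl fun j _ => ?_
    simp [vecMulVec_mulVec, EuclideanSpace.inner_eq_star_dotProduct, dotProduct_comm]
  constructor
  · intro h
    refine Matrix.toLin'.injective (LinearMap.ext fun x => ?_)
    simpa [h (WithLp.toLp 2 x), Matrix.sum_mulVec] using (key (WithLp.toLp 2 x)).symm
  · intro h x
    apply WithLp.ofLp_injective 2
    rw [key, h, one_mulVec]

theorem IsUframe.norm_le_one {n k : ℕ} {v : Fin n → EuclideanSpace ℝ (Fin k)}
    (hv : IsUframe v) (i : Fin n) : ‖v i‖ ≤ 1 := by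
  have h : ∑ j, ⟪v j, v i⟫ ^ 2 = ‖v i‖ ^ 2 := by
    rw [← real_inner_self_eq_norm_sq]
    conv_rhs => rw [← hv (v i), sum_inner]
    refine Finset.sum_congr rfl fun j _ => ?_
    rw [real_inner_smul_left, hv (v i), sq]
  have h1 : ⟪v i, v i⟫ ^ 2 ≤ ‖v i‖ ^ 2 := by
    rw [← h]
    exact Finset.single_le_sum (f := fun j => ⟪v j, v i⟫ ^ 2) (fun j _ => sq_nonneg _)
      (Finset.mem_univ i)
  rw [real_inner_self_eq_norm_sq] at h1
  by_contra! hlt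
  nlinarith [mul_pos (sub_pos.2 hlt) (sub_pos.2 hlt), sq_nonneg (‖v i‖ ^ 2 - 1)]

theorem Fvol_ne_top {n k : ℕ} (v : Fin n → EuclideanSpace ℝ (Fin k)) : Fvol v ≠ ⊤ := by
  refine (Bornology.IsBounded.measure_lt_top ?_).ne
  rw [isBounded_convexHull]
  exact ((Set.finite_range _).union (Set.finite_range _)).isBounded

theorem IsUframe.span_eq_top {n k : ℕ} {v : Fin n → EuclideanSpace ℝ (Fin k)}
    (hv : IsUframe v) : Submodule.span ℝ (Set.range v) = ⊤ := by
  refine Submodule.eq_top_iff'.2 fun x => ?_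
  rw [← hv x]
  exact Submodule.sum_mem _ fun i _ =>
    Submodule.smul_mem _ _ (Submodule.subset_span (Set.mem_range_self i))

theorem IsUframe.Fvol_ne_zero {n k : ℕ} (hn : 0 < n) {v : Fin n → EuclideanSpace ℝ (Fin k)}
    (hv : IsUframe v) : Fvol v ≠ 0 := by
  have hint : (interior (convexHull ℝ
      (Set.range v ∪ Set.range fun i => -v i))).Nonempty := by
    rw [interior_convexHull_nonempty_iff_affineSpan_eq_top,
      AffineSubspace.affineSpan_eq_top_iff_vectorSpan_eq_top_of_nonempty,
      eq_top_iff, ← hv.span_eq_top, Submodule.span_le]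
    · rintro _ ⟨i, rfl⟩
      have h := vsub_mem_vectorSpan ℝ
        (Set.mem_union_left (Set.range fun i => -v i) (Set.mem_range_self (f := v) i))
        (Set.mem_union_right (Set.range v) (Set.mem_range_self (f := fun i => -v i) i))
      have h' := Submodule.smul_mem _ (2⁻¹ : ℝ) h
      rwa [vsub_eq_sub, sub_neg_eq_add, ← two_smul ℝ, inv_smul_smul₀ two_ne_zero] at h'
    · exact ⟨v ⟨0, hn⟩, Or.inl ⟨_, rfl⟩⟩
  exact (Measure.measure_pos_of_nonempty_interior _ hint).ne'

theorem Fvol_map {n k : ℕ} (f : EuclideanSpace ℝ (Fin k) →ₗ[ℝ] EuclideanSpace ℝ (Fin k))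
    (v : Fin n → EuclideanSpace ℝ (Fin k)) :
    Fvol (fun i => f (v i)) = ENNReal.ofReal |LinearMap.det f| * Fvol v := by
  rw [Fvol, Fvol, ← Measure.addHaar_image_linearMap, LinearMap.image_convexHull,
    Set.image_union, ← Set.range_comp, ← Set.range_comp]
  simp [Function.comp_def]

open Matrix in
/-- A system of vectors with nonsingular frame operator is mapped by a linear map to a uframe. -/
theorem exists_isUframe_of_det_pos {n k : ℕ} (s : Fin n → EuclideanSpace ℝ (Fin k))
    (hs : 0 < (∑ j, vecMulVec (s j).ofLp (s j).ofLp).det) :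
    ∃ v : Fin n → EuclideanSpace ℝ (Fin k), IsUframe v ∧ Fvol v =
      ENNReal.ofReal (√(∑ j, vecMulVec (s j).ofLp (s j).ofLp).det)⁻¹ * Fvol s := by
  set A := ∑ j, vecMulVec (s j).ofLp (s j).ofLp with hA
  have hpsd : A.PosSemidef := posSemidef_sum _ fun j _ => by
    simpa using posSemidef_vecMulVec_self_star (R := ℝ) (s j).ofLp
  open scoped MatrixOrder in
  obtain ⟨B, hB⟩ := CStarAlgebra.nonneg_iff_eq_star_mul_self.1 hpsd.nonneg
  rw [star_eq_conjTranspose, conjTranspose_eq_transpose_of_trivial] at hB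
  have hdet : A.det = B.det ^ 2 := by rw [hB, det_mul, det_transpose, sq]
  have hB0 : B.det ≠ 0 := fun h => by simp [hdet, h] at hs
  have hunit : IsUnit B.det := hB0.isUnit
  refine ⟨fun i => toLpLin 2 2 (B⁻¹)ᵀ (s i), ?_, ?_⟩
  · rw [isUframe_iff_sum_vecMulVec]
    calc ∑ j, vecMulVec (toLpLin 2 2 (B⁻¹)ᵀ (s j)).ofLp (toLpLin 2 2 (B⁻¹)ᵀ (s j)).ofLp
        = (B⁻¹)ᵀ * A * B⁻¹ := by
          rw [hA, Finset.mul_sum, Finset.sum_mul]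
          refine Finset.sum_congr rfl fun j _ => ?_
          rw [mul_vecMulVec, vecMulVec_mul, ofLp_toLpLin, toLin'_apply, mulVec_transpose]
      _ = 1 := by
          rw [hB, ← Matrix.mul_assoc, ← transpose_mul, mul_nonsing_inv _ hunit,
            transpose_one, Matrix.one_mul, mul_nonsing_inv _ hunit]
  · rw [Fvol_map, LinearMap.det_toLpLin, det_transpose, det_nonsing_inv,
      Ring.inverse_eq_inv', abs_inv, hdet, Real.sqrt_sq_eq_abs]

open Matrix in
theorem det_one_sub_vecMulVec_add_vecMulVec {k : ℕ} (x y : Fin k → ℝ) :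
    (1 - vecMulVec x x + vecMulVec y y).det =
      (1 - x ⬝ᵥ x) * (1 + y ⬝ᵥ y) + (x ⬝ᵥ y) ^ 2 := by
  have h : 1 - vecMulVec x x + vecMulVec y y = 1 + (of ![-x, y])ᵀ * of ![x, y] := by
    ext a b
    simp [vecMulVec_apply, Matrix.mul_apply, Fin.sum_univ_two]
    ring
  have h2 : of ![x, y] * (of ![-x, y])ᵀ = !![-(x ⬝ᵥ x), x ⬝ᵥ y; -(x ⬝ᵥ y), y ⬝ᵥ y] := by
    ext a b
    fin_cases a <;> fin_cases b <;>
      simp [Matrix.mul_apply, dotProduct, mul_comm]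
  rw [h, det_one_add_mul_comm, h2, det_fin_two]
  simp
  ring

open Matrix in
theorem IsUframe.det_update {n k : ℕ} {v : Fin n → EuclideanSpace ℝ (Fin k)}
    (hv : IsUframe v) (i : Fin n) (w : EuclideanSpace ℝ (Fin k)) :
    (∑ j, vecMulVec (Function.update v i w j).ofLp (Function.update v i w j).ofLp).det =
      (1 - ‖v i‖ ^ 2) * (1 + ‖w‖ ^ 2) + ⟪v i, w⟫ ^ 2 := by
  have h : ∑ j, vecMulVec (Function.update v i w j).ofLp (Function.update v i w j).ofLp =
      1 - vecMulVec (v i).ofLp (v i).ofLp + vecMulVec w.ofLp w.ofLp := by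
    rw [← (isUframe_iff_sum_vecMulVec v).1 hv, ← Finset.add_sum_erase _ _ (Finset.mem_univ i),
      ← Finset.add_sum_erase _ (fun j => vecMulVec (v j).ofLp (v j).ofLp) (Finset.mem_univ i),
      Function.update_self, add_sub_cancel_left, add_comm]
    congr 1
    refine Finset.sum_congr rfl fun j hj => ?_
    rw [Function.update_of_ne (Finset.ne_of_mem_erase hj)]
  rw [h, det_one_sub_vecMulVec_add_vecMulVec]
  simp only [← real_inner_self_eq_norm_sq, EuclideanSpace.inner_eq_star_dotProduct, star_trivial,
    dotProduct_comm w.ofLp]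

theorem Fvol_update_le {n k : ℕ} (v : Fin n → EuclideanSpace ℝ (Fin k)) (i : Fin n)
    {w : EuclideanSpace ℝ (Fin k)}
    (hw : w ∈ convexHull ℝ (Set.range v ∪ Set.range fun j => -v j)) :
    Fvol (Function.update v i w) ≤ Fvol v := by
  have hneg : -w ∈ convexHull ℝ (Set.range v ∪ Set.range fun j => -v j) := by
    have h : -(Set.range v ∪ Set.range fun j => -v j) =
        Set.range v ∪ Set.range fun j => -v j := by
      ext x
      simp only [Set.mem_neg, Set.mem_union, Set.mem_range, neg_inj]
      rw [or_comm]
      simp only [neg_eq_iff_eq_neg]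
    rwa [← h, convexHull_neg, Set.neg_mem_neg]
  refine measure_mono (convexHull_min ?_ (convex_convexHull ℝ _))
  rintro _ (⟨j, rfl⟩ | ⟨j, rfl⟩) <;> rcases eq_or_ne j i with rfl | hj
  · rwa [Function.update_self]
  · rw [Function.update_of_ne hj]
    exact subset_convexHull ℝ _ (Or.inl ⟨j, rfl⟩)
  · simpa only [Function.update_self] using hneg
  · simp only [Function.update_of_ne hj]
    exact subset_convexHull ℝ _ (Or.inr ⟨j, rfl⟩)

/-- At a minimizer of `F`, moving one vector inside the polytope does not increase the determinant
of the frame operator. -/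
theorem IsUframe.det_update_le_one {n k : ℕ} {v : Fin n → EuclideanSpace ℝ (Fin k)}
    (hv : IsUframe v)
    (hmin : ∀ v' : Fin n → EuclideanSpace ℝ (Fin k), IsUframe v' → Fvol v ≤ Fvol v')
    (i : Fin n) {w : EuclideanSpace ℝ (Fin k)}
    (hw : w ∈ convexHull ℝ (Set.range v ∪ Set.range fun j => -v j)) :
    (1 - ‖v i‖ ^ 2) * (1 + ‖w‖ ^ 2) + ⟪v i, w⟫ ^ 2 ≤ 1 := by
  rw [← hv.det_update]
  by_contra! hlt
  obtain ⟨v', hv', hF⟩ := exists_isUframe_of_det_pos _ (one_pos.trans hlt)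
  refine (hmin v' hv').not_gt ?_
  rw [hF]
  have h1 : ENNReal.ofReal (√(∑ j, Matrix.vecMulVec (Function.update v i w j).ofLp
      (Function.update v i w j).ofLp).det)⁻¹ < 1 := by
    rw [ENNReal.ofReal_lt_one]
    exact inv_lt_one_of_one_lt₀ (Real.lt_sqrt_of_sq_lt (by simpa using hlt))
  calc _ ≤ _ * Fvol v := by gcongr; exact Fvol_update_le v i hw
    _ < 1 * Fvol v :=
      ENNReal.mul_lt_mul_left (hv.Fvol_ne_zero i.pos) (Fvol_ne_top v) h1
    _ = Fvol v := one_mul _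

theorem IsUframe.norm_le_one_of_mem_convexHull {n k : ℕ}
    {v : Fin n → EuclideanSpace ℝ (Fin k)} (hv : IsUframe v) {w : EuclideanSpace ℝ (Fin k)}
    (hw : w ∈ convexHull ℝ (Set.range v ∪ Set.range fun j => -v j)) : ‖w‖ ≤ 1 := by
  refine mem_closedBall_zero_iff.1
    (convexHull_min ?_ (convex_closedBall (0 : EuclideanSpace ℝ (Fin k)) 1) hw)
  rintro _ (⟨j, rfl⟩ | ⟨j, rfl⟩) <;> simpa using hv.norm_le_one j

/-- If the minimum of `F` over all `(n,k)`-uframes is attained at `S = {v₁,…,vₙ}`, then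
every `vᵢ` is an extreme point (vertex) of the polytope `conv{±v₁,…,±vₙ}`. -/
theorem min_uframe_vectors_extremePoints {n k : ℕ} (hk : 0 < k) (hkn : k ≤ n)
    (v : Fin n → EuclideanSpace ℝ (Fin k)) (hv : IsUframe v)
    (hmin : ∀ v' : Fin n → EuclideanSpace ℝ (Fin k), IsUframe v' → Fvol v ≤ Fvol v') :
    ∀ i, v i ∈ Set.extremePoints ℝ
      (convexHull ℝ (Set.range v ∪ Set.range fun j => -v j)) := by
  intro i
  refine mem_extremePoints_iff_left.2
    ⟨subset_convexHull ℝ _ (Or.inl ⟨i, rfl⟩), fun x hx y hy hxy => ?_⟩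
  obtain ⟨a, b, ha, hb, hab, hvi⟩ := hxy
  obtain rfl : b = 1 - a := by linarith
  have hnorm : ‖v i‖ ^ 2 = a * ‖x‖ ^ 2 + (1 - a) * ‖y‖ ^ 2 - a * (1 - a) * ‖x - y‖ ^ 2 := by
    rw [← hvi, norm_add_sq_real, norm_sub_sq_real, norm_smul, norm_smul, mul_pow, mul_pow,
      real_inner_smul_left, real_inner_smul_right, Real.norm_eq_abs, Real.norm_eq_abs,
      sq_abs, sq_abs]
    ring
  have hinner : ‖v i‖ ^ 2 = a * ⟪v i, x⟫ + (1 - a) * ⟪v i, y⟫ := by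
    rw [← real_inner_self_eq_norm_sq, ← real_inner_smul_right, ← real_inner_smul_right,
      ← inner_add_right, hvi]
  suffices hxy : ‖x - y‖ ^ 2 ≤ 0 by
    obtain rfl : x = y := by
      rw [← sub_eq_zero, ← norm_eq_zero]
      exact pow_eq_zero_iff two_ne_zero |>.1 (hxy.antisymm (sq_nonneg _))
    rw [← hvi, ← add_smul, hab, one_smul]
  have hab' : 0 < a * (1 - a) := mul_pos ha hb
  have hx1 : ‖x‖ ^ 2 ≤ 1 :=
    pow_le_one₀ (norm_nonneg _) (hv.norm_le_one_of_mem_convexHull hx)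
  have hy1 : ‖y‖ ^ 2 ≤ 1 :=
    pow_le_one₀ (norm_nonneg _) (hv.norm_le_one_of_mem_convexHull hy)
  have hdx := hv.det_update_le_one hmin i hx
  have hdy := hv.det_update_le_one hmin i hy
  have hv1 : ‖v i‖ ^ 2 ≤ 1 := pow_le_one₀ (norm_nonneg _) (hv.norm_le_one i)
  rcases hv1.eq_or_lt with h1 | h1
  · by_contra! hpos
    nlinarith [mul_pos hab' hpos, mul_le_mul_of_nonneg_left hx1 ha.le,
      mul_le_mul_of_nonneg_left hy1 hb.le]
  · by_contra! hpos
    have hsq : (‖v i‖ ^ 2) ^ 2 ≤ a * ⟪v i, x⟫ ^ 2 + (1 - a) * ⟪v i, y⟫ ^ 2 := by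
      rw [hinner]
      nlinarith [mul_nonneg hab'.le (sq_nonneg (⟪v i, x⟫ - ⟪v i, y⟫))]
    have hconv : a * ‖x‖ ^ 2 + (1 - a) * ‖y‖ ^ 2 =
        ‖v i‖ ^ 2 + a * (1 - a) * ‖x - y‖ ^ 2 := by linarith
    have hlt : 0 < (1 - ‖v i‖ ^ 2) * (a * (1 - a) * ‖x - y‖ ^ 2) :=
      mul_pos (sub_pos.2 h1) (mul_pos hab' hpos)
    have hcomb : (1 - ‖v i‖ ^ 2) * (1 + (a * ‖x‖ ^ 2 + (1 - a) * ‖y‖ ^ 2)) +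
        (a * ⟪v i, x⟫ ^ 2 + (1 - a) * ⟪v i, y⟫ ^ 2) ≤ 1 := by
      linarith [mul_le_mul_of_nonneg_left hdx ha.le, mul_le_mul_of_nonneg_left hdy hb.le]
    rw [hconv] at hcomb
    linarith
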